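/- Let g: ℝ^m → ℝ^q be twice continuously differentiable, Γ := {y ∈ ℝ^m | g(y) ≤ 0}, and suppose the metric subregularity constraint qualification holds for the system g(y) ≤ 0 at y ∈ Γ. Let y* ∈ ℝ^m, λ ∈ Λ(y, y*), and v ∈ K(y, y*). Then the convex-analysis normal cone to the critical cone satisfies N_{K(y,y*)}(v) = {∇g(y)^T μ | μ ∈ ℝ^q, μ^T ∇g(y) v = 0, μ_i ≥ 0 for all i with g_i(y) = 0 and λ_i = 0, μ_i = 0 for all i with g_i(y) < 0}. -/

import Mathlib

open Filter Topology Set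
open scoped RealInnerProductSpace

noncomputable section

/-- `ℝ^d` as a Euclidean space. -/
abbrev Eu (d : ℕ) := EuclideanSpace ℝ (Fin d)

/-- The (Bouligand–Severi) tangent/contingent cone to `Ω` at `z`. -/
def tcone {E : Type*} [NormedAddCommGroup E] [NormedSpace ℝ E] (Ω : Set E) (z : E) : Set E :=
  {u | ∃ t : ℕ → ℝ, ∃ w : ℕ → E, (∀ k, 0 < t k) ∧
    Tendsto t atTop (𝓝 0) ∧ Tendsto w atTop (𝓝 u) ∧ ∀ k, z + t k • w k ∈ Ω}

/-- The (Fréchet) regular normal cone to `Ω` at `zb`. -/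
def rnc {E : Type*} [NormedAddCommGroup E] [InnerProductSpace ℝ E]
    (Ω : Set E) (zb : E) : Set E :=
  {v | ∀ ε > (0 : ℝ), ∃ δ > (0 : ℝ), ∀ z ∈ Ω, ‖z - zb‖ < δ →
    ⟪v, z - zb⟫ ≤ ε * ‖z - zb‖}

/-- Metric subregularity of a set-valued map at a point of its graph. -/
def msr {E F : Type*} [NormedAddCommGroup E] [NormedAddCommGroup F]
    (M : E → Set F) (zb : E) (wb : F) : Prop :=
  ∃ κ : ℝ, 0 < κ ∧ ∃ W ∈ 𝓝 zb, ∀ z ∈ W,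
    EMetric.infEdist z {z' | wb ∈ M z'} ≤ ENNReal.ofReal κ * EMetric.infEdist wb (M z)

/-- The lower-level feasible set `Γ = {y | g(y) ≤ 0}`. -/
def Gam {m q : ℕ} (g : Eu m → Eu q) : Set (Eu m) := {y | ∀ i, g y i ≤ 0}

/-- The multiplier set `Λ(y, y*) = {λ ≥ 0 | ∇g(y)ᵀλ = y*, λ_i = 0 for i ∉ I(y)}`. -/
def Lam {m q : ℕ} (g : Eu m → Eu q) (y ys : Eu m) : Set (Eu q) :=
  {l | (∀ i, 0 ≤ l i) ∧ ContinuousLinearMap.adjoint (fderiv ℝ g y) l = ys ∧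
    ∀ i, g y i ≠ 0 → l i = 0}

/-- The critical cone `K(y, y*) = T_Γ(y) ∩ {y*}ᗮ`. -/
def Kcone {m q : ℕ} (g : Eu m → Eu q) (y ys : Eu m) : Set (Eu m) :=
  tcone (Gam g) y ∩ {v | ⟪v, ys⟫ = 0}

/-- The convex-analysis normal cone to a (convex) set `Ω` at `z`. -/
def cnc {E : Type*} [NormedAddCommGroup E] [InnerProductSpace ℝ E]
    (Ω : Set E) (z : E) : Set E :=
  {w | ∀ z' ∈ Ω, ⟪w, z' - z⟫ ≤ 0}

/-- `∇²(λᵀg)(y) v`, the Hessian of `y ↦ ⟨λ, g(y)⟩` applied to `v`, realized as the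
derivative at `y` of the gradient map `y' ↦ ∇g(y')ᵀλ` in the direction `v`. -/
def hessA {m q : ℕ} (g : Eu m → Eu q) (l : Eu q) (y v : Eu m) : Eu m :=
  fderiv ℝ (fun y' => ContinuousLinearMap.adjoint (fderiv ℝ g y') l) y v

/-- The directional multiplier set
`Λ(y, y*; v) = argmax {vᵀ∇²(λᵀg)(y)v | λ ∈ Λ(y, y*)}`. -/
def dirLam {m q : ℕ} (g : Eu m → Eu q) (y ys v : Eu m) : Set (Eu q) :=
  {l | l ∈ Lam g y ys ∧ ∀ l' ∈ Lam g y ys, ⟪v, hessA g l' y v⟫ ≤ ⟪v, hessA g l y v⟫}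

/-- The extreme points `E(y, y*)` of `Λ(y, y*)`: those multipliers `λ` for which the
active gradients `{∇g_i(y) | λ_i > 0}` are linearly independent. -/
def ExtPts {m q : ℕ} (g : Eu m → Eu q) (y ys : Eu m) : Set (Eu q) :=
  {l | l ∈ Lam g y ys ∧
    LinearIndependent ℝ (fun i : {i : Fin q // 0 < l i} =>
      fderiv ℝ (fun y' => g y' i.1) y)}

/-- The graph of the regular normal cone map `y ↦ N̂_Γ(y)`. -/
def gphN {m q : ℕ} (g : Eu m → Eu q) : Set (Eu m × Eu m) :=
  {p | p.1 ∈ Gam g ∧ p.2 ∈ rnc (Gam g) p.1}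

/-- MSCQ for the lower-level system `g(y) ≤ 0` at `yb`: metric subregularity of
`y ↦ g(y) − ℝ^q₋` at `(yb, 0)`. -/
def MSCQlow {m q : ℕ} (g : Eu m → Eu q) (yb : Eu m) : Prop :=
  msr (fun y => {w : Eu q | ∀ i, g y i - w i ≤ 0}) yb 0

/-- The **Farkas lemma** for finitely many linear functionals. -/
theorem farkas_finset {V ι : Type*} [AddCommGroup V] [Module ℝ V] (s : Finset ι) :
    ∀ (a : ι → V →ₗ[ℝ] ℝ) (b : V →ₗ[ℝ] ℝ), (∀ x, (∀ i ∈ s, a i x ≤ 0) → b x ≤ 0) →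
      ∃ μ : ι → ℝ, (∀ i, 0 ≤ μ i) ∧ ∀ x, b x = ∑ i ∈ s, μ i * a i x := by
  classical
  induction s using Finset.induction_on with
  | empty =>
    intro a b h
    refine ⟨0, fun _ => le_rfl, fun x => ?_⟩
    have h1 := h x (by simp)
    have h2 := h (-x) (by simp)
    simp only [map_neg] at h2
    simp only [Finset.sum_empty]
    linarith
  | insert j s hj ih =>
    intro a b h
    by_cases hs : ∀ x, (∀ i ∈ s, a i x ≤ 0) → b x ≤ 0
    · obtain ⟨μ, hμ, hb⟩ := ih a b hs
      refine ⟨Function.update μ j 0, fun i => ?_, fun x => ?_⟩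
      · by_cases hij : i = j
        · subst hij; simp
        · simpa [Function.update_of_ne hij] using hμ i
      · rw [Finset.sum_insert hj, hb x]
        simp only [Function.update_self, zero_mul, zero_add]
        refine Finset.sum_congr rfl fun i hi => ?_
        rw [Function.update_of_ne (ne_of_mem_of_not_mem hi hj)]
    · push Not at hs
      obtain ⟨x₀, hx₀, hbx₀⟩ := hs
      have hax₀ : 0 < a j x₀ := by
        by_contra hle
        refine absurd (h x₀ fun i hi => ?_) (not_le.mpr hbx₀)
        rcases Finset.mem_insert.mp hi with rfl | hi
        · exact not_lt.mp hle
        · exact hx₀ i hi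
      let p : V →ₗ[ℝ] V := LinearMap.id - (a j).smulRight ((a j x₀)⁻¹ • x₀)
      have hp : ∀ (f : V →ₗ[ℝ] ℝ) x, f (p x) = f x - a j x * ((a j x₀)⁻¹ * f x₀) := by
        intro f x
        simp [p]
      obtain ⟨μ, hμ, hb⟩ := ih (fun i => (a i).comp p) (b.comp p) (by
        intro x hx
        refine h (p x) fun i hi => ?_
        rcases Finset.mem_insert.mp hi with rfl | hi
        · rw [hp, inv_mul_cancel₀ hax₀.ne']
          simp
        · exact hx i hi)
      have hsum : ∑ i ∈ s, μ i * a i x₀ ≤ 0 :=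
        Finset.sum_nonpos fun i hi => mul_nonpos_of_nonneg_of_nonpos (hμ i) (hx₀ i hi)
      refine ⟨Function.update μ j ((a j x₀)⁻¹ * (b x₀ - ∑ i ∈ s, μ i * a i x₀)),
        fun i => ?_, fun x => ?_⟩
      · by_cases hij : i = j
        · subst hij
          rw [Function.update_self]
          exact mul_nonneg (inv_nonneg.mpr hax₀.le) (by linarith)
        · simpa [Function.update_of_ne hij] using hμ i
      · have hbx := hb x
        simp only [LinearMap.comp_apply, hp] at hbx
        rw [Finset.sum_insert hj, Function.update_self]
        have hcongr : ∑ i ∈ s, Function.update μ j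
            ((a j x₀)⁻¹ * (b x₀ - ∑ i ∈ s, μ i * a i x₀)) i * a i x = ∑ i ∈ s, μ i * a i x := by
          refine Finset.sum_congr rfl fun i hi => ?_
          rw [Function.update_of_ne (ne_of_mem_of_not_mem hi hj)]
        have hsplit : ∑ i ∈ s, μ i * (a i x - a j x * ((a j x₀)⁻¹ * a i x₀)) =
            ∑ i ∈ s, μ i * a i x - a j x * (a j x₀)⁻¹ * ∑ i ∈ s, μ i * a i x₀ := by
          rw [Finset.mul_sum, ← Finset.sum_sub_distrib]
          exact Finset.sum_congr rfl fun i _ => by ring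
        rw [hcongr]
        rw [hsplit] at hbx
        linear_combination hbx

/-- Directions of the contingent cone satisfy the linearized active constraints. -/
theorem fderiv_nonpos_of_mem_tcone {m q : ℕ} {g : Eu m → Eu q} {y u : Eu m}
    (hg : DifferentiableAt ℝ g y) (hu : u ∈ tcone (Gam g) y) {i : Fin q} (hi : g y i = 0) :
    fderiv ℝ g y u i ≤ 0 := by
  obtain ⟨t, w, ht, ht0, hw, hmem⟩ := hu
  have hlim : Tendsto (fun k => (t k)⁻¹ • (g (y + t k • w k) - g y)) atTop
      (𝓝 (fderiv ℝ g y u)) := by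
    refine (hasFDerivWithinAt_univ.2 hg.hasFDerivAt).lim (l := atTop) (c := fun k => (t k)⁻¹) (d := fun k => t k • w k) ?_ (.of_forall fun _ => mem_univ _) ?_
    · simpa using (ht0.smul hw)
    · refine hw.congr fun k => ?_
      rw [smul_smul, inv_mul_cancel₀ (ht k).ne', one_smul]
  have hlim_i := ((EuclideanSpace.proj (𝕜 := ℝ) i).continuous.tendsto _).comp hlim
  refine le_of_tendsto' hlim_i fun k => ?_
  change (t k)⁻¹ * (g (y + t k • w k) i - g y i) ≤ 0
  rw [hi, sub_zero]
  exact mul_nonpos_of_nonneg_of_nonpos (inv_nonneg.mpr (ht k).le) (hmem k i)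

/-- Along a direction satisfying the linearized active constraints, the constraint violation is
of smaller order than the step length. -/
theorem eventually_le_mul_of_linearized {m q : ℕ} {g : Eu m → Eu q} {y u : Eu m}
    (hg : DifferentiableAt ℝ g y) (hy : y ∈ Gam g)
    (hu : ∀ i, g y i = 0 → fderiv ℝ g y u i ≤ 0) {ε : ℝ} (hε : 0 < ε) :
    ∀ᶠ t in 𝓝[>] (0 : ℝ), ∀ i, g (y + t • u) i ≤ ε * t := by
  rw [eventually_all]
  intro i
  have hderiv : HasDerivAt (fun t : ℝ => g (y + t • u) i) (fderiv ℝ g y u i) 0 := by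
    have h1 : HasDerivAt (fun t : ℝ => y + t • u) u 0 := by
      simpa using ((hasDerivAt_id (0 : ℝ)).smul_const u).const_add y
    have h2 : HasFDerivAt g (fderiv ℝ g y) (y + (0 : ℝ) • u) := by simpa using hg.hasFDerivAt
    exact (EuclideanSpace.proj (𝕜 := ℝ) i).hasFDerivAt.comp_hasDerivAt _
      (h2.comp_hasDerivAt 0 h1)
  rcases (hy i).lt_or_eq with hlt | heq
  · have h0 : (fun t : ℝ => g (y + t • u) i) 0 < 0 := by simpa using hlt
    filter_upwards [nhdsWithin_le_nhds (hderiv.continuousAt.eventually_lt_const h0),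
      self_mem_nhdsWithin] with t ht htpos
    exact ht.le.trans (mul_pos hε htpos).le
  · have hlo := hderiv.isLittleO.def hε
    filter_upwards [nhdsWithin_le_nhds hlo, self_mem_nhdsWithin] with t ht htpos
    have htpos : 0 < t := htpos
    simp only [zero_smul, add_zero, heq, sub_zero, smul_eq_mul, Real.norm_eq_abs,
      abs_of_pos htpos] at ht
    have := (le_abs_self _).trans ht
    nlinarith [hu i heq]

/-- Under MSCQ, every direction satisfying the linearized active constraints belongs to the
contingent cone of the feasible set. -/
theorem mem_tcone_of_MSCQlow {m q : ℕ} {g : Eu m → Eu q} {y u : Eu m}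
    (hg : DifferentiableAt ℝ g y) (hy : y ∈ Gam g) (hM : MSCQlow g y)
    (hu : ∀ i, g y i = 0 → fderiv ℝ g y u i ≤ 0) : u ∈ tcone (Gam g) y := by
  obtain ⟨κ, hκ, W, hW, hsub⟩ := hM
  let e : Eu q := WithLp.toLp 2 fun _ => 1
  have key : ∀ ε > (0 : ℝ), ∃ t : ℝ, ∃ w : Eu m, 0 < t ∧ t < ε ∧
      ‖w - u‖ < ε * (κ * ‖e‖ + 1) ∧ y + t • w ∈ Gam g := by
    intro ε hε
    have hline : ∀ᶠ t in 𝓝[>] (0 : ℝ), y + t • u ∈ W := by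
      refine nhdsWithin_le_nhds ?_
      have hc : Continuous fun t : ℝ => y + t • u := by fun_prop
      exact hc.continuousAt (by simpa using hW)
    have hsmall : ∀ᶠ t in 𝓝[>] (0 : ℝ), t < ε :=
      nhdsWithin_le_nhds (eventually_lt_nhds hε)
    obtain ⟨t, htW, htε, hgt, htpos⟩ := (hline.and (hsmall.and
      ((eventually_le_mul_of_linearized hg hy hu hε).and self_mem_nhdsWithin))).exists
    have htpos : 0 < t := htpos
    have hdist : Metric.infEDist (0 : Eu q) {w : Eu q | ∀ i, g (y + t • u) i - w i ≤ 0} ≤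
        ENNReal.ofReal (ε * t * ‖e‖) := by
      refine (Metric.infEDist_le_edist_of_mem (y := (ε * t) • e) fun i => ?_).trans ?_
      · simpa [e] using hgt i
      · rw [edist_dist, dist_zero_left, norm_smul, Real.norm_of_nonneg (by positivity)]
    have hlt : Metric.infEDist (y + t • u) {z' | (0 : Eu q) ∈ {w : Eu q | ∀ i, g z' i - w i ≤ 0}} <
        ENNReal.ofReal (t * (ε * (κ * ‖e‖ + 1))) := by
      refine (hsub _ htW).trans_lt ((mul_le_mul_right hdist _).trans_lt ?_)
      rw [← ENNReal.ofReal_mul hκ.le]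
      refine (ENNReal.ofReal_lt_ofReal_iff (by positivity)).mpr ?_
      nlinarith [mul_pos hε htpos]
    obtain ⟨z, hz, hzlt⟩ := Metric.infEDist_lt_iff.mp hlt
    rw [edist_dist, ENNReal.ofReal_lt_ofReal_iff (by positivity), dist_eq_norm'] at hzlt
    refine ⟨t, t⁻¹ • (z - y), htpos, htε, ?_, ?_⟩
    · have hrw : t⁻¹ • (z - y) - u = t⁻¹ • (z - (y + t • u)) := by
        rw [← sub_sub, smul_sub t⁻¹ (z - y), smul_smul, inv_mul_cancel₀ htpos.ne', one_smul]
      rw [hrw, norm_smul, norm_inv, Real.norm_of_nonneg htpos.le, inv_mul_lt_iff₀ htpos]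
      exact hzlt
    · rw [smul_smul, mul_inv_cancel₀ htpos.ne', one_smul, add_sub_cancel]
      intro i
      simpa using hz i
  choose t w ht htlt hw hmem using fun k : ℕ => key (1 / ((k : ℝ) + 1)) (by positivity)
  refine ⟨t, w, ht, ?_, ?_, hmem⟩
  · exact squeeze_zero (fun k => (ht k).le) (fun k => (htlt k).le)
      tendsto_one_div_add_atTop_nhds_zero_nat
  · rw [tendsto_iff_norm_sub_tendsto_zero]
    refine squeeze_zero (fun k => norm_nonneg _) (fun k => (hw k).le) ?_
    simpa using (tendsto_one_div_add_atTop_nhds_zero_nat (𝕜 := ℝ)).mul_const (κ * ‖e‖ + 1)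

/-- The transposed Jacobian paired with a direction, written out in coordinates. -/
theorem inner_adjoint_fderiv {m q : ℕ} (A : Eu m →L[ℝ] Eu q) (μ : Eu q) (u : Eu m) :
    ⟪ContinuousLinearMap.adjoint A μ, u⟫ = ∑ i, μ i * A u i := by
  rw [ContinuousLinearMap.adjoint_inner_left, PiLp.inner_apply]
  exact Finset.sum_congr rfl fun i _ => by simp [mul_comm]

/-- under MSCQ for `g(y) ≤ 0` at `y ∈ Γ`, for `λ ∈ Λ(y, y*)` and
`v ∈ K(y, y*)`, the convex-analysis normal cone to the critical cone is
`N_{K(y,y*)}(v) = {∇g(y)ᵀμ | μᵀ∇g(y)v = 0, μ_i ≥ 0 (g_i(y) = 0, λ_i = 0),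
μ_i = 0 (g_i(y) < 0)}`. -/
theorem stmt_14 {m q : ℕ} (g : Eu m → Eu q) (hg : ContDiff ℝ 2 g)
    (y : Eu m) (hy : y ∈ Gam g) (hMSCQ : MSCQlow g y)
    (ys : Eu m) (l : Eu q) (hl : l ∈ Lam g y ys)
    (v : Eu m) (hv : v ∈ Kcone g y ys) :
    cnc (Kcone g y ys) v =
      {w | ∃ μ : Eu q, w = ContinuousLinearMap.adjoint (fderiv ℝ g y) μ ∧
        ⟪μ, fderiv ℝ g y v⟫ = 0 ∧
        (∀ i, g y i = 0 → l i = 0 → 0 ≤ μ i) ∧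
        (∀ i, g y i < 0 → μ i = 0)} := by
  have hd : DifferentiableAt ℝ g y := hg.differentiable (by norm_num) y
  obtain ⟨hl0, rfl, hlI⟩ := hl
  set A := fderiv ℝ g y
  have hact : ∀ u ∈ Kcone g y (ContinuousLinearMap.adjoint A l), ∀ i, g y i = 0 → A u i ≤ 0 :=
    fun u hu i hi => fderiv_nonpos_of_mem_tcone hd hu.1 hi
  have hterm : ∀ u : Eu m, (∀ i, g y i = 0 → A u i ≤ 0) → ∀ i, l i * A u i ≤ 0 := by
    intro u hu i
    by_cases hi : g y i = 0
    · exact mul_nonpos_of_nonneg_of_nonpos (hl0 i) (hu i hi)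
    · simp [hlI i hi]
  ext w
  constructor
  · intro hw
    have hmemK : ∀ u, (∀ i, g y i = 0 → A u i ≤ 0) →
        0 ≤ ⟪ContinuousLinearMap.adjoint A l, u⟫ →
        u ∈ Kcone g y (ContinuousLinearMap.adjoint A l) := by
      intro u hu h0
      refine ⟨mem_tcone_of_MSCQlow hd hy hMSCQ hu, ?_⟩
      rw [mem_ofPred_eq, real_inner_comm]
      refine le_antisymm ?_ h0
      rw [inner_adjoint_fderiv]
      exact Finset.sum_nonpos fun i _ => hterm u hu i
    have hv0 : ⟪ContinuousLinearMap.adjoint A l, v⟫ = 0 := by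
      rw [real_inner_comm]; exact hv.2
    have hpolar : ∀ u, (∀ i, g y i = 0 → A u i ≤ 0) →
        0 ≤ ⟪ContinuousLinearMap.adjoint A l, u⟫ → ⟪w, u⟫ ≤ 0 := by
      intro u hu h0
      have hsum := hw (v + u) (hmemK _ (fun i hi => ?_) ?_)
      · simpa using hsum
      · rw [map_add, PiLp.add_apply]
        exact add_nonpos (hact v hv i hi) (hu i hi)
      · rw [inner_add_right, hv0, zero_add]
        exact h0
    have hwv : ⟪w, v⟫ = 0 := by
      refine le_antisymm (hpolar v (hact v hv) hv0.ge) ?_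
      have hzero := hw 0 (hmemK 0 (by simp) (by simp))
      simpa using hzero
    obtain ⟨ν, hν, hwν⟩ := farkas_finset (V := Eu m) (Finset.univ : Finset (Option (Fin q)))
      (fun o => o.elim (-(innerSL ℝ (ContinuousLinearMap.adjoint A l)).toLinearMap)
        (fun i => if g y i = 0 then ((EuclideanSpace.proj (𝕜 := ℝ) i).comp A).toLinearMap else 0))
      (innerSL ℝ w).toLinearMap (by
        intro u hu
        refine hpolar u (fun i hi => ?_) ?_
        · simpa [hi] using hu (some i) (Finset.mem_univ _)
        · simpa using hu none (Finset.mem_univ _))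
    let μ : Eu q := WithLp.toLp 2 fun i => (if g y i = 0 then ν (some i) else 0) - ν none * l i
    have hwμ : w = ContinuousLinearMap.adjoint A μ := by
      refine ext_inner_right ℝ fun u => ?_
      have hu := hwν u
      simp only [Fintype.sum_option, Option.elim_none, Option.elim_some,
        ContinuousLinearMap.coe_coe, LinearMap.neg_apply, innerSL_apply_apply] at hu
      rw [hu, inner_adjoint_fderiv, inner_adjoint_fderiv, mul_neg, Finset.mul_sum,
        ← Finset.sum_neg_distrib, ← Finset.sum_add_distrib]
      refine Finset.sum_congr rfl fun i _ => ?_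
      by_cases hi : g y i = 0
      · simp [μ, hi]
        ring
      · simp [μ, hi, mul_assoc]
    refine ⟨μ, hwμ, ?_, fun i hi hli => ?_, fun i hi => ?_⟩
    · rw [← ContinuousLinearMap.adjoint_inner_left, ← hwμ, hwv]
    · simpa [μ, hi, hli] using hν (some i)
    · simp [μ, hi.ne, hlI i hi.ne]
  · rintro ⟨μ, rfl, hμv, hμ0, hμI⟩ z hz
    rw [inner_sub_right, ContinuousLinearMap.adjoint_inner_left A v, hμv, sub_zero,
      inner_adjoint_fderiv]
    have hzero : ∀ i, l i * A z i = 0 := by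
      have hs : ∑ i, l i * A z i = 0 := by
        rw [← inner_adjoint_fderiv, real_inner_comm]
        exact hz.2
      exact fun i => (Finset.sum_eq_zero_iff_of_nonpos
        fun i _ => hterm z (hact z hz) i).mp hs i (Finset.mem_univ i)
    refine Finset.sum_nonpos fun i _ => ?_
    rcases (hy i).lt_or_eq with hlt | heq
    · simp [hμI i hlt]
    · by_cases hli : l i = 0
      · exact mul_nonpos_of_nonneg_of_nonpos (hμ0 i heq hli) (hact z hz i heq)
      · simp [(mul_eq_zero.mp (hzero i)).resolve_left hli]
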